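/- Let X_1,…,X_K be mutually independent finitely-valued random variables and let (X_1,…,X_K,Y,Z) be jointly distributed. Then for all subsets S₀ ⊆ 𝒦′ ⊆ 𝒦, I(X_{𝒦′};Y|X_{𝒦∖𝒦′}) − I(X_{𝒦′};Z|X_{𝒦∖𝒦′}) ≤ [ I(X_{𝒦′∖S₀};Y|X_{𝒦∖(𝒦′∖S₀)}) − I(X_{𝒦′∖S₀};Z|X_{𝒦∖𝒦′}) ] + [ I(X_{S₀};Y|X_{𝒦∖S₀}) − I(X_{S₀};Z|X_{𝒦∖𝒦′}) ]. -/

import Mathlib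

open scoped Classical

noncomputable section

/-- Probability that random variable `X` takes value `x`, under pmf `p` on a finite sample space. -/
def probOf {Ω α : Type} [Fintype Ω] (p : Ω → ℝ) (X : Ω → α) (x : α) : ℝ :=
  ∑ ω, if X ω = x then p ω else 0

/-- Shannon entropy of a finitely-valued random variable. -/
def Hent {Ω α : Type} [Fintype Ω] [Fintype α] (p : Ω → ℝ) (X : Ω → α) : ℝ :=
  -∑ x, probOf p X x * Real.log (probOf p X x)

/-- Conditional entropy `H(X | C)`. -/
def condHent {Ω α γ : Type} [Fintype Ω] [Fintype α] [Fintype γ]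
    (p : Ω → ℝ) (X : Ω → α) (C : Ω → γ) : ℝ :=
  Hent p (fun ω => (X ω, C ω)) - Hent p C

/-- Conditional mutual information `I(A;B | C)`. -/
def IcondMut {Ω α β γ : Type} [Fintype Ω] [Fintype α] [Fintype β] [Fintype γ]
    (p : Ω → ℝ) (A : Ω → α) (B : Ω → β) (C : Ω → γ) : ℝ :=
  condHent p A C + condHent p B C - condHent p (fun ω => (A ω, B ω)) C

/-- Mutual information `I(A;B)`. -/
def Imut {Ω α β : Type} [Fintype Ω] [Fintype α] [Fintype β]
    (p : Ω → ℝ) (A : Ω → α) (B : Ω → β) : ℝ :=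
  Hent p A + Hent p B - Hent p (fun ω => (A ω, B ω))

/-- `p` is a probability mass function. -/
def IsPMF {Ω : Type} [Fintype Ω] (p : Ω → ℝ) : Prop :=
  (∀ ω, 0 ≤ p ω) ∧ ∑ ω, p ω = 1

/-- The tuple `X_S = (X_k)_{k ∈ S}` as a random variable. -/
def tup {Ω ι : Type} {𝒳 : ι → Type} (X : ∀ k, Ω → 𝒳 k) (S : Finset ι) :
    Ω → ∀ k : S, 𝒳 k.1 :=
  fun ω k => X k.1 ω

/-- The random variables `X_1, …, X_K` are mutually independent. -/
def MutIndep {Ω ι : Type} [Fintype Ω] [Fintype ι] {𝒳 : ι → Type} [∀ k, Fintype (𝒳 k)]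
    (p : Ω → ℝ) (X : ∀ k, Ω → 𝒳 k) : Prop :=
  ∀ x : ∀ k, 𝒳 k, probOf p (fun ω k => X k ω) x = ∏ k, probOf p (X k) (x k)

section Entropy

variable {Ω α β γ : Type} [Fintype Ω] {p : Ω → ℝ}

lemma probOf_nonneg (hp : ∀ ω, 0 ≤ p ω) (X : Ω → α) (x : α) : 0 ≤ probOf p X x :=
  Finset.sum_nonneg fun ω _ => by split_ifs <;> simp [hp ω]

lemma le_probOf_self (hp : ∀ ω, 0 ≤ p ω) (X : Ω → α) (ω : Ω) : p ω ≤ probOf p X (X ω) := by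
  have h := Finset.single_le_sum (f := fun ω' => if X ω' = X ω then p ω' else 0)
    (fun ω' _ => by split_ifs <;> simp [hp ω']) (Finset.mem_univ ω)
  simpa [probOf] using h

variable [Fintype α]

lemma sum_probOf_mul (p : Ω → ℝ) (X : Ω → α) (g : α → ℝ) :
    ∑ x, probOf p X x * g x = ∑ ω, p ω * g (X ω) := by
  simp only [probOf, Finset.sum_mul]
  rw [Finset.sum_comm]
  simp

lemma sum_probOf (p : Ω → ℝ) (X : Ω → α) : ∑ x, probOf p X x = ∑ ω, p ω := by
  simpa using sum_probOf_mul p X fun _ => 1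

lemma sum_probOf_prod_left (p : Ω → ℝ) (A : Ω → α) (C : Ω → γ) (c : γ) :
    ∑ a, probOf p (fun ω => (A ω, C ω)) (a, c) = probOf p C c := by
  simp only [probOf, Prod.mk.injEq]
  rw [Finset.sum_comm]
  refine Finset.sum_congr rfl fun ω _ => ?_
  by_cases h : C ω = c <;> simp [h]

variable [Fintype β] [Fintype γ]

lemma Hent_eq_sum (p : Ω → ℝ) (X : Ω → α) :
    Hent p X = -∑ ω, p ω * Real.log (probOf p X (X ω)) := by
  rw [Hent, sum_probOf_mul p X fun x => Real.log (probOf p X x)]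

/-- Entropy depends only on the partition of the sample space induced by the random variable. -/
lemma Hent_congr (p : Ω → ℝ) {X : Ω → α} {Y : Ω → β}
    (h : ∀ ω ω', X ω = X ω' ↔ Y ω = Y ω') : Hent p X = Hent p Y := by
  simp only [Hent_eq_sum, probOf, h]

lemma Hent_unit (hp : IsPMF p) : Hent p (fun _ => ()) = 0 := by
  simp [Hent_eq_sum, probOf, hp.2]

/-- The conditionally independent coupling of the marginals `(A, C)` and `(B, C)` has total mass
one. -/
lemma sum_probOf_mul_probOf_div (p : Ω → ℝ) (A : Ω → α) (B : Ω → β) (C : Ω → γ) :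
    ∑ x : (α × β) × γ, probOf p (fun ω => (A ω, C ω)) (x.1.1, x.2) *
      probOf p (fun ω => (B ω, C ω)) (x.1.2, x.2) / probOf p C x.2 = ∑ ω, p ω := by
  rw [← sum_probOf p C, Fintype.sum_prod_type_right]
  refine Finset.sum_congr rfl fun c _ => ?_
  rw [Fintype.sum_prod_type]
  simp only [← Finset.sum_div, ← Finset.mul_sum]
  rw [sum_probOf_prod_left, ← Finset.sum_mul, sum_probOf_prod_left, mul_self_div_self]

lemma IcondMut_nonneg (hp : IsPMF p) (A : Ω → α) (B : Ω → β) (C : Ω → γ) :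
    0 ≤ IcondMut p A B C := by
  set q := probOf p (fun ω => ((A ω, B ω), C ω)) with hq
  set r := probOf p (fun ω => (A ω, C ω)) with hr
  set s := probOf p (fun ω => (B ω, C ω)) with hs
  set t := probOf p C with ht
  have hr0 : ∀ x, 0 ≤ r x := probOf_nonneg hp.1 _
  have hs0 : ∀ x, 0 ≤ s x := probOf_nonneg hp.1 _
  have ht0 : ∀ x, 0 ≤ t x := probOf_nonneg hp.1 _
  have hq0 : ∀ x, 0 ≤ q x := probOf_nonneg hp.1 _
  let g : (α × β) × γ → ℝ := fun x => r (x.1.1, x.2) * s (x.1.2, x.2) / t x.2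
  have hg0 : ∀ x, 0 ≤ g x := fun x => div_nonneg (mul_nonneg (hr0 _) (hs0 _)) (ht0 _)
  have hmass : ∑ ω, p ω * (g ((A ω, B ω), C ω) / q ((A ω, B ω), C ω)) ≤ ∑ ω, p ω := by
    rw [← sum_probOf_mul p (fun ω => ((A ω, B ω), C ω)) fun x => g x / q x,
      ← sum_probOf_mul_probOf_div p A B C]
    refine Finset.sum_le_sum fun x _ => ?_
    change q x * (g x / q x) ≤ g x
    rcases (hq0 x).eq_or_lt with h | h
    · rw [← h, zero_mul]
      exact hg0 x
    · rw [mul_div_cancel₀ _ h.ne']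
  have hpoint : ∀ ω, p ω * (1 - g ((A ω, B ω), C ω) / q ((A ω, B ω), C ω)) ≤
      p ω * (Real.log (q ((A ω, B ω), C ω)) + Real.log (t (C ω)) -
        Real.log (r (A ω, C ω)) - Real.log (s (B ω, C ω))) := by
    intro ω
    rcases (hp.1 ω).eq_or_lt with h | h
    · simp [← h]
    have hq1 : 0 < q ((A ω, B ω), C ω) := h.trans_le (le_probOf_self hp.1 _ ω)
    have hr1 : 0 < r (A ω, C ω) := h.trans_le (le_probOf_self hp.1 (fun ω => (A ω, C ω)) ω)
    have hs1 : 0 < s (B ω, C ω) := h.trans_le (le_probOf_self hp.1 (fun ω => (B ω, C ω)) ω)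
    have ht1 : 0 < t (C ω) := h.trans_le (le_probOf_self hp.1 _ ω)
    refine mul_le_mul_of_nonneg_left ?_ h.le
    have hg1 : 0 < g ((A ω, B ω), C ω) := div_pos (mul_pos hr1 hs1) ht1
    have hlog := Real.log_le_sub_one_of_pos (div_pos hg1 hq1)
    rw [Real.log_div hg1.ne' hq1.ne', Real.log_div (mul_pos hr1 hs1).ne' ht1.ne',
      Real.log_mul hr1.ne' hs1.ne'] at hlog
    linarith
  have hsum := Finset.sum_le_sum fun ω (_ : ω ∈ Finset.univ) => hpoint ω
  simp only [mul_sub, mul_add, mul_one, Finset.sum_sub_distrib, Finset.sum_add_distrib] at hsum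
  simp only [IcondMut, condHent, Hent_eq_sum]
  linarith

lemma Hent_prod_le (hp : IsPMF p) (A : Ω → α) (B : Ω → β) :
    Hent p (fun ω => (A ω, B ω)) ≤ Hent p A + Hent p B := by
  have h := IcondMut_nonneg hp A B fun _ => ()
  have hA : Hent p (fun ω => (A ω, ())) = Hent p A := Hent_congr p (by simp)
  have hB : Hent p (fun ω => (B ω, ())) = Hent p B := Hent_congr p (by simp)
  have hAB : Hent p (fun ω => ((A ω, B ω), ())) = Hent p (fun ω => (A ω, B ω)) :=
    Hent_congr p (by simp)
  simp only [IcondMut, condHent, hA, hB, hAB, Hent_unit hp] at h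
  linarith

end Entropy

section Tuples

variable {Ω ι β : Type} {𝒳 : ι → Type}

lemma tup_eq_iff (X : ∀ k, Ω → 𝒳 k) (S : Finset ι) (ω ω' : Ω) :
    tup X S ω = tup X S ω' ↔ ∀ k ∈ S, X k ω = X k ω' := by
  simp [tup, funext_iff]

variable [DecidableEq ι]

lemma tup_union_eq_iff (X : ∀ k, Ω → 𝒳 k) (S T : Finset ι) (ω ω' : Ω) :
    tup X (S ∪ T) ω = tup X (S ∪ T) ω' ↔
      tup X S ω = tup X S ω' ∧ tup X T ω = tup X T ω' := by
  simp only [tup_eq_iff, Finset.mem_union, or_imp, forall_and]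

variable [Fintype Ω] [Fintype β] [∀ k, Fintype (𝒳 k)] {p : Ω → ℝ}

lemma Hent_tup_union (p : Ω → ℝ) (X : ∀ k, Ω → 𝒳 k) (S T : Finset ι) :
    Hent p (tup X (S ∪ T)) = Hent p (fun ω => (tup X S ω, tup X T ω)) :=
  Hent_congr p fun ω ω' => by rw [tup_union_eq_iff, Prod.mk.injEq]

lemma IcondMut_tup_eq (p : Ω → ℝ) (X : ∀ k, Ω → 𝒳 k) (Y : Ω → β) (S T : Finset ι) :
    IcondMut p (tup X S) Y (tup X T) =
      Hent p (tup X (S ∪ T)) + Hent p (fun ω => (tup X T ω, Y ω)) - Hent p (tup X T) -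
        Hent p (fun ω => (tup X (S ∪ T) ω, Y ω)) := by
  have h₁ : Hent p (fun ω => (Y ω, tup X T ω)) = Hent p (fun ω => (tup X T ω, Y ω)) :=
    Hent_congr p (by simp [and_comm])
  have h₂ : Hent p (fun ω => ((tup X S ω, Y ω), tup X T ω)) =
      Hent p (fun ω => (tup X (S ∪ T) ω, Y ω)) :=
    Hent_congr p fun ω ω' => by simp only [Prod.mk.injEq, tup_union_eq_iff]; tauto
  simp only [IcondMut, condHent, h₁, h₂, Hent_tup_union p X S T]
  ring

/-- Submodularity of `S ↦ H(X_S, Y)`. -/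
lemma Hent_tup_prod_submodular (hp : IsPMF p) (X : ∀ k, Ω → 𝒳 k) (Y : Ω → β) (S T : Finset ι) :
    Hent p (fun ω => (tup X (S ∪ T) ω, Y ω)) + Hent p (fun ω => (tup X (S ∩ T) ω, Y ω)) ≤
      Hent p (fun ω => (tup X S ω, Y ω)) + Hent p (fun ω => (tup X T ω, Y ω)) := by
  have h := IcondMut_nonneg hp (tup X S) (tup X T) fun ω => (tup X (S ∩ T) ω, Y ω)
  have hS : Hent p (fun ω => (tup X S ω, tup X (S ∩ T) ω, Y ω)) =
      Hent p (fun ω => (tup X S ω, Y ω)) :=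
    Hent_congr p fun ω ω' => by
      simp only [Prod.mk.injEq, tup_eq_iff, Finset.mem_inter]; tauto
  have hT : Hent p (fun ω => (tup X T ω, tup X (S ∩ T) ω, Y ω)) =
      Hent p (fun ω => (tup X T ω, Y ω)) :=
    Hent_congr p fun ω ω' => by
      simp only [Prod.mk.injEq, tup_eq_iff, Finset.mem_inter]; tauto
  have hST : Hent p (fun ω => ((tup X S ω, tup X T ω), tup X (S ∩ T) ω, Y ω)) =
      Hent p (fun ω => (tup X (S ∪ T) ω, Y ω)) :=
    Hent_congr p fun ω ω' => by
      rw [Prod.mk.injEq, Prod.mk.injEq, Prod.mk.injEq, Prod.mk.injEq, tup_union_eq_iff]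
      simp only [tup_eq_iff, Finset.mem_inter]
      tauto
  simp only [IcondMut, condHent, hS, hT, hST] at h
  linarith

lemma Hent_tup_union_le (hp : IsPMF p) (X : ∀ k, Ω → 𝒳 k) (S T : Finset ι) :
    Hent p (tup X (S ∪ T)) ≤ Hent p (tup X S) + Hent p (tup X T) :=
  (Hent_tup_union p X S T).trans_le (Hent_prod_le hp _ _)

lemma Hent_tup_le_sum (hp : IsPMF p) (X : ∀ k, Ω → 𝒳 k) (S : Finset ι) :
    Hent p (tup X S) ≤ ∑ k ∈ S, Hent p (X k) := by
  induction S using Finset.induction_on with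
  | empty =>
    rw [Finset.sum_empty, ← Hent_unit hp]
    exact (Hent_congr p (by simp [tup_eq_iff])).le
  | insert k S hk ih =>
    have hsingle : Hent p (tup X {k}) = Hent p (X k) := Hent_congr p (by simp [tup_eq_iff])
    have h := Hent_tup_union_le hp X {k} S
    rw [hsingle] at h
    rw [Finset.sum_insert hk, Finset.insert_eq]
    linarith

variable [Fintype ι]

lemma MutIndep.Hent_tup_univ (hp : IsPMF p) {X : ∀ k, Ω → 𝒳 k} (hind : MutIndep p X) :
    Hent p (tup X Finset.univ) = ∑ k, Hent p (X k) := by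
  have h : Hent p (tup X Finset.univ) = Hent p (fun ω k => X k ω) :=
    Hent_congr p fun ω ω' => by
      rw [tup_eq_iff, funext_iff]
      simp only [Finset.mem_univ, forall_const]
  simp only [h, Hent_eq_sum, Finset.sum_neg_distrib]
  rw [Finset.sum_comm]
  congr 1
  refine Finset.sum_congr rfl fun ω _ => ?_
  rw [hind, ← Finset.mul_sum]
  rcases (hp.1 ω).eq_or_lt with h0 | h0
  · simp [← h0]
  · rw [Real.log_prod fun k _ => (h0.trans_le (le_probOf_self hp.1 (X k) ω)).ne']

lemma MutIndep.Hent_tup (hp : IsPMF p) {X : ∀ k, Ω → 𝒳 k} (hind : MutIndep p X) (S : Finset ι) :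
    Hent p (tup X S) = ∑ k ∈ S, Hent p (X k) := by
  have h₁ := Hent_tup_union_le hp X S Sᶜ
  rw [Finset.union_compl, hind.Hent_tup_univ hp, ← Finset.sum_add_sum_compl S] at h₁
  have h₂ := Hent_tup_le_sum hp X Sᶜ
  have h₃ := Hent_tup_le_sum hp X S
  linarith

lemma MutIndep.Hent_tup_modular (hp : IsPMF p) {X : ∀ k, Ω → 𝒳 k} (hind : MutIndep p X)
    (S T : Finset ι) :
    Hent p (tup X (S ∪ T)) + Hent p (tup X (S ∩ T)) = Hent p (tup X S) + Hent p (tup X T) := by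
  simp only [hind.Hent_tup hp]
  exact Finset.sum_union_inter

end Tuples

theorem stmt12 {K : ℕ} (hK : 1 ≤ K) {Ω : Type} [Fintype Ω]
    {𝒳 : Fin K → Type} [∀ k, Fintype (𝒳 k)] {𝒴 𝒵 : Type} [Fintype 𝒴] [Fintype 𝒵]
    (p : Ω → ℝ) (hp : IsPMF p)
    (X : ∀ k, Ω → 𝒳 k) (Y : Ω → 𝒴) (Z : Ω → 𝒵) (hind : MutIndep p X)
    (S₀ K' : Finset (Fin K)) (hS₀ : S₀ ⊆ K') :
    IcondMut p (tup X K') Y (tup X (Finset.univ \ K')) -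
        IcondMut p (tup X K') Z (tup X (Finset.univ \ K')) ≤
      (IcondMut p (tup X (K' \ S₀)) Y (tup X (Finset.univ \ (K' \ S₀))) -
          IcondMut p (tup X (K' \ S₀)) Z (tup X (Finset.univ \ K'))) +
        (IcondMut p (tup X S₀) Y (tup X (Finset.univ \ S₀)) -
          IcondMut p (tup X S₀) Z (tup X (Finset.univ \ K'))) := by
  have hU : K' ∪ (Finset.univ \ K') = Finset.univ := by simp
  have hUA : (K' \ S₀) ∪ (Finset.univ \ (K' \ S₀)) = Finset.univ := by simp
  have hUB : S₀ ∪ (Finset.univ \ S₀) = Finset.univ := by simp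
  have hA : (K' \ S₀) ∪ (Finset.univ \ K') = Finset.univ \ S₀ := by
    ext k
    have := @hS₀ k
    simp only [Finset.mem_union, Finset.mem_sdiff, Finset.mem_univ, true_and]
    tauto
  have hB : S₀ ∪ (Finset.univ \ K') = Finset.univ \ (K' \ S₀) := by
    ext k
    have := @hS₀ k
    simp only [Finset.mem_union, Finset.mem_sdiff, Finset.mem_univ, true_and]
    tauto
  have hunion : (Finset.univ \ S₀) ∪ (Finset.univ \ (K' \ S₀)) = Finset.univ := by
    ext k
    simp only [Finset.mem_union, Finset.mem_sdiff, Finset.mem_univ, true_and, iff_true]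
    tauto
  have hinter : (Finset.univ \ S₀) ∩ (Finset.univ \ (K' \ S₀)) = Finset.univ \ K' := by
    ext k
    have := @hS₀ k
    simp only [Finset.mem_inter, Finset.mem_sdiff, Finset.mem_univ, true_and]
    tauto
  have hY := Hent_tup_prod_submodular hp X Y (Finset.univ \ S₀) (Finset.univ \ (K' \ S₀))
  have hZ := Hent_tup_prod_submodular hp X Z (Finset.univ \ S₀) (Finset.univ \ (K' \ S₀))
  have hX := hind.Hent_tup_modular hp (Finset.univ \ S₀) (Finset.univ \ (K' \ S₀))
  rw [hunion, hinter] at hY hZ hX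
  simp only [IcondMut_tup_eq]
  rw [hU, hUA, hUB, hA, hB]
  linarith
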